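/- Let 𝔤 be a finite-dimensional simple Lie algebra over ℂ. The ℂ-vector space of symmetric bilinear forms B on the Takiff algebra T(𝔤) satisfying B([(z,0),u],v) + B(u,[(z,0),v]) = 0 for all z ∈ 𝔤 and u, v ∈ T(𝔤) (invariance under the subalgebra 𝔤 × {0}) is three-dimensional, spanned by κ_a, κ_b and κ_c. -/

import Mathlib

/-- The Takiff bracket on `L × L`: `[(x,x'),(y,y')] = ([x,y], [x,y'] + [x',y])`,
i.e. the bracket of the Takiff algebra `𝔤 ⊗ ℂ[ε]/(ε²)`. -/
def takiffBracket {L : Type*} [LieRing L] (u v : L × L) : L × L :=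
  (⁅u.1, v.1⁆, ⁅u.1, v.2⁆ + ⁅u.2, v.1⁆)

/-- The bilinear form `κ_a((x,x'),(y,y')) = κ(x,y)` on the Takiff algebra,
where `κ` is the Killing form of `L`. -/
noncomputable def kappaA (L : Type*) [LieRing L] [LieAlgebra ℂ L] :
    (L × L) →ₗ[ℂ] (L × L) →ₗ[ℂ] ℂ :=
  LinearMap.mk₂ ℂ (fun u v => killingForm ℂ L u.1 v.1)
    (fun _ _ _ => by simp) (fun _ _ _ => by simp)
    (fun _ _ _ => by simp) (fun _ _ _ => by simp)

/-- The bilinear form `κ_b((x,x'),(y,y')) = κ(x,y') + κ(x',y)` on the Takiff algebra. -/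
noncomputable def kappaB (L : Type*) [LieRing L] [LieAlgebra ℂ L] :
    (L × L) →ₗ[ℂ] (L × L) →ₗ[ℂ] ℂ :=
  LinearMap.mk₂ ℂ (fun u v => killingForm ℂ L u.1 v.2 + killingForm ℂ L u.2 v.1)
    (fun _ _ _ => by simp; ring) (fun _ _ _ => by simp; ring)
    (fun _ _ _ => by simp; ring) (fun _ _ _ => by simp; ring)

/-- The bilinear form `κ_c((x,x'),(y,y')) = κ(x',y')` on the Takiff algebra. -/
noncomputable def kappaC (L : Type*) [LieRing L] [LieAlgebra ℂ L] :
    (L × L) →ₗ[ℂ] (L × L) →ₗ[ℂ] ℂ :=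
  LinearMap.mk₂ ℂ (fun u v => killingForm ℂ L u.2 v.2)
    (fun _ _ _ => by simp) (fun _ _ _ => by simp)
    (fun _ _ _ => by simp) (fun _ _ _ => by simp)

/-- The space of symmetric bilinear forms on the Takiff algebra `T(𝔤) = L × L` which are
invariant under the subalgebra `𝔤 × {0}`. -/
noncomputable def gInvSymForms (L : Type*) [LieRing L] [LieAlgebra ℂ L] :
    Submodule ℂ ((L × L) →ₗ[ℂ] (L × L) →ₗ[ℂ] ℂ) where
  carrier := {B | (∀ u v, B u v = B v u) ∧
    ∀ (z : L) (u v : L × L),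
      B (takiffBracket (z, 0) u) v + B u (takiffBracket (z, 0) v) = 0}
  add_mem' := by
    rintro f g ⟨hf1, hf2⟩ ⟨hg1, hg2⟩
    refine ⟨fun u v => ?_, fun z u v => ?_⟩
    · simp only [LinearMap.add_apply, hf1 u v, hg1 u v]
    · simp only [LinearMap.add_apply]
      linear_combination hf2 z u v + hg2 z u v
  zero_mem' := ⟨fun u v => rfl, fun z u v => by simp⟩
  smul_mem' := by
    rintro c f ⟨hf1, hf2⟩
    refine ⟨fun u v => ?_, fun z u v => ?_⟩
    · simp only [LinearMap.smul_apply, hf1 u v]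
    · simp only [LinearMap.smul_apply, smul_eq_mul]
      linear_combination c * hf2 z u v

/-- Schur's lemma for bilinear forms: every invariant bilinear form on a finite-dimensional simple
Lie algebra over `ℂ` is a multiple of the Killing form. -/
theorem exists_eq_smul_killingForm {L : Type*} [LieRing L] [LieAlgebra ℂ L]
    [FiniteDimensional ℂ L] [LieAlgebra.IsSimple ℂ L] (f : L →ₗ[ℂ] L →ₗ[ℂ] ℂ)
    (hf : ∀ z x y : L, f ⁅z, x⁆ y + f x ⁅z, y⁆ = 0) :
    ∃ c : ℂ, ∀ x y, f x y = c * killingForm ℂ L x y := by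
  have : Nontrivial L := LieAlgebra.IsSimple.nontrivial ℂ L
  let e := LinearMap.BilinForm.toDual (killingForm ℂ L)
    (LieAlgebra.IsKilling.killingForm_nondegenerate ℂ L)
  obtain ⟨c, hc⟩ := Module.End.exists_eigenvalue (e.symm.toLinearMap ∘ₗ f : Module.End ℂ L)
  obtain ⟨v, hv⟩ := hc.exists_hasEigenvector
  have hfv : f v = c • killingForm ℂ L v := by
    have h := congrArg e hv.apply_eq_smul
    rw [map_smul] at h
    ext y
    simpa [e, LinearMap.BilinForm.toDual_def] using LinearMap.congr_fun h y
  let I : LieIdeal ℂ L :=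
    { LinearMap.ker (f - c • killingForm ℂ L) with
      lie_mem := by
        intro z x hx
        have hx' : ∀ y, f x y = c * killingForm ℂ L x y := fun y => by
          simpa [sub_eq_zero] using
            LinearMap.congr_fun (show (f - c • killingForm ℂ L) x = 0 from hx) y
        change (f - c • killingForm ℂ L) ⁅z, x⁆ = 0
        ext y
        have hk : killingForm ℂ L ⁅z, x⁆ y = -killingForm ℂ L x ⁅z, y⁆ :=
          LieModule.traceForm_apply_lie_apply' ℂ L L z x y
        simp only [LinearMap.sub_apply, LinearMap.smul_apply, smul_eq_mul, LinearMap.zero_apply, hk]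
        linear_combination hf z x y - hx' ⁅z, y⁆ }
  have hvI : v ∈ I := by
    change (f - c • killingForm ℂ L) v = 0
    simp [hfv]
  have hI : I = ⊤ := (LieAlgebra.IsSimple.eq_bot_or_eq_top (R := ℂ) I).resolve_left fun h =>
    hv.2 (by simpa [h] using hvI)
  refine ⟨c, fun x y => ?_⟩
  have hx : x ∈ I := hI ▸ LieSubmodule.mem_top x
  simpa [sub_eq_zero] using LinearMap.congr_fun (show (f - c • killingForm ℂ L) x = 0 from hx) y

/-- The Killing form of a finite-dimensional simple Lie algebra over `ℂ` is not identically zero. -/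
theorem exists_killingForm_ne_zero (L : Type*) [LieRing L] [LieAlgebra ℂ L]
    [FiniteDimensional ℂ L] [LieAlgebra.IsSimple ℂ L] :
    ∃ x y : L, killingForm ℂ L x y ≠ 0 := by
  have : Nontrivial L := LieAlgebra.IsSimple.nontrivial ℂ L
  obtain ⟨x, hx⟩ := exists_ne (0 : L)
  by_contra! h
  have hmem : x ∈ LinearMap.ker (killingForm ℂ L) := LinearMap.ext (h x)
  exact hx (by simpa using hmem)

/-- The forms `κ_a`, `κ_b` and `κ_c` are linearly independent. -/
theorem linearIndependent_kappa (L : Type*) [LieRing L] [LieAlgebra ℂ L]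
    [FiniteDimensional ℂ L] [LieAlgebra.IsSimple ℂ L] :
    LinearIndependent ℂ ![kappaA L, kappaB L, kappaC L] := by
  obtain ⟨x, y, hxy⟩ := exists_killingForm_ne_zero L
  rw [Fintype.linearIndependent_iff]
  intro g hg
  have h (u v : L × L) : g 0 * kappaA L u v + g 1 * kappaB L u v + g 2 * kappaC L u v = 0 := by
    simpa [Fin.sum_univ_three] using LinearMap.congr_fun₂ hg u v
  have ha := h (x, 0) (y, 0)
  have hb := h (x, 0) (0, y)
  have hc := h (0, x) (0, y)
  simp [kappaA, kappaB, kappaC, hxy] at ha hb hc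
  intro i
  fin_cases i <;> assumption

/-- The forms `κ_a`, `κ_b` and `κ_c` are symmetric and invariant under `𝔤 × {0}`. -/
theorem kappa_mem_gInvSymForms (L : Type*) [LieRing L] [LieAlgebra ℂ L] :
    kappaA L ∈ gInvSymForms L ∧ kappaB L ∈ gInvSymForms L ∧ kappaC L ∈ gInvSymForms L := by
  have hk (z x y : L) : killingForm ℂ L ⁅z, x⁆ y = -killingForm ℂ L x ⁅z, y⁆ :=
    LieModule.traceForm_apply_lie_apply' ℂ L L z x y
  have hs (x y : L) : killingForm ℂ L x y = killingForm ℂ L y x :=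
    LieModule.traceForm_comm ℂ L L x y
  refine ⟨⟨fun u v => ?_, fun z u v => ?_⟩, ⟨fun u v => ?_, fun z u v => ?_⟩,
    ⟨fun u v => ?_, fun z u v => ?_⟩⟩
  · exact hs _ _
  · simp [kappaA, takiffBracket, hk]
  · simp only [kappaB, LinearMap.mk₂_apply]
    rw [hs u.1, hs u.2, add_comm]
  · simp only [kappaB, takiffBracket, LinearMap.mk₂_apply, zero_lie, add_zero, hk]
    ring
  · exact hs _ _
  · simp [kappaC, takiffBracket, hk]

/-- Every symmetric form invariant under `𝔤 × {0}` is a combination of `κ_a`, `κ_b` and `κ_c`. -/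
theorem gInvSymForms_le_span (L : Type*) [LieRing L] [LieAlgebra ℂ L]
    [FiniteDimensional ℂ L] [LieAlgebra.IsSimple ℂ L] :
    gInvSymForms L ≤ Submodule.span ℂ {kappaA L, kappaB L, kappaC L} := by
  rintro B ⟨hsymm, hinv⟩
  obtain ⟨a, ha⟩ := exists_eq_smul_killingForm
    (B.compl₁₂ (LinearMap.inl ℂ L L) (LinearMap.inl ℂ L L))
    fun z x y => by simpa [takiffBracket] using hinv z (x, 0) (y, 0)
  obtain ⟨b, hb⟩ := exists_eq_smul_killingForm
    (B.compl₁₂ (LinearMap.inl ℂ L L) (LinearMap.inr ℂ L L))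
    fun z x y => by simpa [takiffBracket] using hinv z (x, 0) (0, y)
  obtain ⟨c, hc⟩ := exists_eq_smul_killingForm
    (B.compl₁₂ (LinearMap.inr ℂ L L) (LinearMap.inr ℂ L L))
    fun z x y => by simpa [takiffBracket] using hinv z (0, x) (0, y)
  simp only [LinearMap.compl₁₂_apply, LinearMap.inl_apply, LinearMap.inr_apply] at ha hb hc
  refine Submodule.mem_span_triple.2 ⟨a, b, c, LinearMap.ext₂ fun u v => ?_⟩
  have hsplit (w : L × L) : w = (w.1, 0) + (0, w.2) := by simp
  have hB : B u v = a * killingForm ℂ L u.1 v.1 + b * killingForm ℂ L u.1 v.2 +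
      (b * killingForm ℂ L v.1 u.2 + c * killingForm ℂ L u.2 v.2) := by
    conv_lhs => rw [hsplit u, hsplit v]
    rw [map_add B, LinearMap.add_apply, map_add, map_add, hsymm (0, u.2) (v.1, 0), ha, hb, hb, hc]
  rw [hB, show killingForm ℂ L v.1 u.2 = killingForm ℂ L u.2 v.1 from
    LieModule.traceForm_comm ℂ L L _ _]
  simp only [kappaA, kappaB, kappaC, LinearMap.add_apply, LinearMap.smul_apply,
    LinearMap.mk₂_apply, smul_eq_mul]
  ring

/-- For a finite-dimensional simple Lie algebra `L` over `ℂ`, the space of symmetric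
bilinear forms on the Takiff algebra `T(𝔤)` invariant under `𝔤 × {0}` is three-dimensional,
spanned by `κ_a`, `κ_b` and `κ_c`. -/
theorem gInvSymForms_eq_span
    (L : Type*) [LieRing L] [LieAlgebra ℂ L] [FiniteDimensional ℂ L]
    [LieAlgebra.IsSimple ℂ L] :
    Module.finrank ℂ (gInvSymForms L) = 3 ∧
      gInvSymForms L = Submodule.span ℂ {kappaA L, kappaB L, kappaC L} := by
  have heq : gInvSymForms L = Submodule.span ℂ {kappaA L, kappaB L, kappaC L} := by
    refine le_antisymm (gInvSymForms_le_span L) (Submodule.span_le.2 ?_)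
    obtain ⟨ha, hb, hc⟩ := kappa_mem_gInvSymForms L
    rintro _ (rfl | rfl | rfl) <;> assumption
  refine ⟨?_, heq⟩
  have h := finrank_span_eq_card (linearIndependent_kappa L)
  rw [Matrix.range_cons, Matrix.range_cons, Matrix.range_cons, Matrix.range_empty,
    Set.union_empty, Set.singleton_union, Set.singleton_union] at h
  rw [heq, h, Fintype.card_fin]
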